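/- Let I ⊆ ℕ with ℓ ∉ I, let i be an even natural number, and let ψ be an ML_A⁺(I)-formula equivalent to [A_ℓ]^i p. Then |ψ| ≥ 2^{i/2}. -/

import Mathlib

set_option autoImplicit false
attribute [local instance] Classical.propDecidable

/-- A Kripke model with `n` modalities: a nonempty set of worlds, `n` accessibility
relations, and a propositional assignment (variables are indexed by `ℕ`). -/
structure KripkeModel (n : ℕ) : Type 1 where
  W : Type
  nonempty : Nonempty W
  R : Fin n → W → W → Prop
  val : ℕ → Set W

/-- A pointed Kripke model. -/
structure PointedModel (n : ℕ) : Type 1 where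
  M : KripkeModel n
  w : M.W

/-- Successor selection functions of arity `n`. -/
def SSF (n : ℕ) : Type 1 :=
  (M : KripkeModel n) → M.W → Set M.W

/-- Formulas of the modal logic `ML⁺(𝒪)` for a set `𝒪` of successor selection functions. -/
inductive MLFormula {n : ℕ} (Os : Set (SSF n)) : Type 1 where
  | var : ℕ → MLFormula Os
  | neg : MLFormula Os → MLFormula Os
  | or : MLFormula Os → MLFormula Os → MLFormula Os
  | box : Os → MLFormula Os → MLFormula Os

/-- Size of a formula: number of nodes of its syntax tree. -/
def MLFormula.size {n : ℕ} {Os : Set (SSF n)} : MLFormula Os → ℕ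
  | .var _ => 1
  | .neg φ => φ.size + 1
  | .or φ ψ => φ.size + ψ.size + 1
  | .box _ φ => φ.size + 1

/-- Satisfaction of an `ML⁺(𝒪)` formula in a pointed model. -/
def Satisfies {n : ℕ} {Os : Set (SSF n)} (M : KripkeModel n) : M.W → MLFormula Os → Prop
  | w, .var p => w ∈ M.val p
  | w, .neg φ => ¬ Satisfies M w φ
  | w, .or φ ψ => Satisfies M w φ ∨ Satisfies M w ψ
  | w, .box O φ => ∀ w' ∈ O.val M w, Satisfies M w' φ

/-- Two formulas (of possibly different logics) are equivalent if they are satisfied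
by exactly the same pointed models. -/
def FEquiv {n : ℕ} {Os₁ Os₂ : Set (SSF n)} (φ : MLFormula Os₁) (ψ : MLFormula Os₂) : Prop :=
  ∀ (M : KripkeModel n) (w : M.W), Satisfies M w φ ↔ Satisfies M w ψ

/-- `ML⁺(𝒪₂)` is at least as expressive as `ML⁺(𝒪₁)`. -/
def LeExpr {n : ℕ} (Os₁ Os₂ : Set (SSF n)) : Prop :=
  ∀ φ : MLFormula Os₁, ∃ ψ : MLFormula Os₂, FEquiv φ ψ

/-- `ML⁺(𝒪₂)` is at least as succinct as `ML⁺(𝒪₁)`: there is a fixed polynomial `p` such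
that every `ML⁺(𝒪₁)`-formula has an equivalent `ML⁺(𝒪₂)`-formula of polynomially bounded size. -/
def LePoly {n : ℕ} (Os₁ Os₂ : Set (SSF n)) : Prop :=
  ∃ p : Polynomial ℕ, ∀ φ : MLFormula Os₁, ∃ ψ : MLFormula Os₂,
    FEquiv φ ψ ∧ ψ.size ≤ p.eval φ.size

def EquallyExpressive {n : ℕ} (Os₁ Os₂ : Set (SSF n)) : Prop :=
  LeExpr Os₁ Os₂ ∧ LeExpr Os₂ Os₁

/-- `ML⁺(𝒪₁)` is exponentially more succinct than `ML⁺(𝒪₂)`: there is a sequence of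
`ML⁺(𝒪₁)`-formulas of linearly bounded size and some `c > 1` such that every equivalent
`ML⁺(𝒪₂)`-formula of the `i`-th formula has size at least `c ^ i`. -/
def ExpMoreSuccinct {n : ℕ} (Os₁ Os₂ : Set (SSF n)) : Prop :=
  ∃ (φ : ℕ → MLFormula Os₁) (a b : ℕ) (c : ℝ), 1 < c ∧
    (∀ i : ℕ, (φ i).size ≤ a * i + b) ∧
    ∀ (i : ℕ) (ψ : MLFormula Os₂), FEquiv (φ i) ψ → c ^ i ≤ ((ψ.size : ℕ) : ℝ)

/-- The successor selection function given by an `n`-ary Boolean function `f`: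
it selects the `f`-successors. -/
noncomputable def OfBool {n : ℕ} (f : (Fin n → Bool) → Bool) : SSF n :=
  fun M w => {w' | f (fun j => decide (M.R j w w')) = true}

/-- The set of successor selection functions given by a set of `n`-ary Boolean functions. -/
def boolSSFs {n : ℕ} (F : Set ((Fin n → Bool) → Bool)) : Set (SSF n) :=
  OfBool '' F

/-- `sSucc M s w w'` : `w'` is an `s`-successor of `w` in `M`. -/
def sSucc {n : ℕ} (M : KripkeModel n) : List (Fin n) → M.W → M.W → Prop
  | [], w, w' => w' = w
  | a :: s, w, w' => ∃ u, M.R a w u ∧ sSucc M s u w'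

/-- The successor selection function given by a language `L`: it selects all
`s`-successors for words `s ∈ L`. -/
def OfLang {n : ℕ} (L : Set (List (Fin n))) : SSF n :=
  fun M w => {w' | ∃ s ∈ L, sSucc M s w w'}

/-- The set of successor selection functions given by a set of languages. -/
def langSSFs {n : ℕ} (Ls : Set (Set (List (Fin n)))) : Set (SSF n) :=
  OfLang '' Ls

/-- The operators of standard multimodal logic `ML_n`: the singleton one-letter languages. -/
def MLn_ops (n : ℕ) : Set (SSF n) := {O | ∃ j : Fin n, O = OfLang {[j]}}

/-- `nestBoxes s φ` is the formula `□_{s₁}□_{s₂}…□_{s_k} φ`. -/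
def nestBoxes {n : ℕ} : List (Fin n) → MLFormula (MLn_ops n) → MLFormula (MLn_ops n)
  | [], φ => φ
  | j :: s, φ => .box ⟨OfLang {[j]}, ⟨j, rfl⟩⟩ (nestBoxes s φ)

/-! ### Alternation languages (alphabet {1,2} represented as `Fin 2`, letter `0` ↦ 1, `1` ↦ 2) -/

/-- The (0-based) `j`-th letter of the alternating word starting with letter `b`. -/
def altLetter (b : Fin 2) (j : ℕ) : Fin 2 := if j % 2 = 0 then b else b + 1

/-- The alternating word of length `ℓ` starting with letter `b`. -/
def altWord (b : Fin 2) (ℓ : ℕ) : List (Fin 2) := (List.range ℓ).map (altLetter b)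

/-- The alternation language `A_ℓ` of length `ℓ`. -/
def altLang (ℓ : ℕ) : Set (List (Fin 2)) := {altWord 0 ℓ, altWord 1 ℓ}

/-- Operators of the logic `ML_A(I)`. -/
def MLA_ops (I : Set ℕ) : Set (SSF 2) := (fun ℓ => OfLang (altLang ℓ)) '' I

/-- Operators of the logic `ML_A⁺(I)` (alternation operators plus the classical boxes). -/
def MLAp_ops (I : Set ℕ) : Set (SSF 2) :=
  MLA_ops I ∪ {OfLang {[(0 : Fin 2)]}, OfLang {[(1 : Fin 2)]}}

/-- The formula `[A_ℓ]^i p` (where `p` is the fixed propositional variable `0`),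
as a formula of `ML_A({ℓ})`. -/
def boxAltIter (ℓ : ℕ) : ℕ → MLFormula (MLA_ops {ℓ})
  | 0 => .var 0
  | i + 1 => .box ⟨OfLang (altLang ℓ), ⟨ℓ, rfl, rfl⟩⟩ (boxAltIter ℓ i)

/-! ### Formula size games -/

/-- The class `{(M,w') | (M,w) ∈ C, w' ∈ O(M,w)}` used in the box move. -/
def boxImage {n : ℕ} (O : SSF n) (C : Set (PointedModel n)) : Set (PointedModel n) :=
  {q | ∃ m ∈ C, ∃ w' ∈ O m.M m.w, q = ⟨m.M, w'⟩}

/-- Closed game trees of the formula size game `FSG(𝒪)`, with root label `⟨C∘D⟩`.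
Each constructor corresponds to a legal Spoiler move; leaves are atomic moves. -/
inductive GameTree {n : ℕ} (Os : Set (SSF n)) :
    Set (PointedModel n) → Set (PointedModel n) → Type 1 where
  | atom (p : ℕ) (C D : Set (PointedModel n))
      (hC : ∀ q ∈ C, q.w ∈ q.M.val p) (hD : ∀ q ∈ D, q.w ∉ q.M.val p) :
      GameTree Os C D
  | not (C D : Set (PointedModel n)) (t : GameTree Os D C) : GameTree Os C D
  | or (C₁ C₂ D : Set (PointedModel n))
      (t₁ : GameTree Os C₁ D) (t₂ : GameTree Os C₂ D) : GameTree Os (C₁ ∪ C₂) D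
  | box (O : SSF n) (hO : O ∈ Os) (C D D₁ : Set (PointedModel n))
      (hD : ∀ q ∈ D, ∃ w' ∈ O q.M q.w, (⟨q.M, w'⟩ : PointedModel n) ∈ D₁)
      (t : GameTree Os (boxImage O C) D₁) : GameTree Os C D

/-- Number of nodes of a game tree. -/
def gameTreeSize {n : ℕ} {Os : Set (SSF n)} :
    ∀ (C D : Set (PointedModel n)), GameTree Os C D → ℕ
  | _, _, .atom _ _ _ _ _ => 1
  | _, _, .not _ _ t => gameTreeSize _ _ t + 1
  | _, _, .or _ _ _ t₁ t₂ => gameTreeSize _ _ t₁ + gameTreeSize _ _ t₂ + 1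
  | _, _, .box _ _ _ _ _ _ t => gameTreeSize _ _ t + 1

/-- `IsSubtree t T bl par` : the root of `t` is a node of `T`; `bl` is the sequence of
successor selection functions labelling box moves on the path from `T`'s root to this node
(excluding the node's own label), and `par = true` iff the path contains an even number
of `¬`-labels. -/
inductive IsSubtree {n : ℕ} {Os : Set (SSF n)} :
    ∀ {C D A B : Set (PointedModel n)},
      GameTree Os C D → GameTree Os A B → List (SSF n) → Bool → Prop where
  | refl {A B : Set (PointedModel n)} (t : GameTree Os A B) : IsSubtree t t [] true
  | not {C D A B : Set (PointedModel n)} {bl : List (SSF n)} {par : Bool}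
      {t : GameTree Os C D} {t' : GameTree Os B A} :
      IsSubtree t t' bl par → IsSubtree t (.not A B t') bl (!par)
  | orLeft {C D A₁ A₂ B : Set (PointedModel n)} {bl : List (SSF n)} {par : Bool}
      {t : GameTree Os C D} {t₁ : GameTree Os A₁ B} (t₂ : GameTree Os A₂ B) :
      IsSubtree t t₁ bl par → IsSubtree t (.or A₁ A₂ B t₁ t₂) bl par
  | orRight {C D A₁ A₂ B : Set (PointedModel n)} {bl : List (SSF n)} {par : Bool}
      {t : GameTree Os C D} (t₁ : GameTree Os A₁ B) {t₂ : GameTree Os A₂ B} :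
      IsSubtree t t₂ bl par → IsSubtree t (.or A₁ A₂ B t₁ t₂) bl par
  | box {C D A B D₁ : Set (PointedModel n)} {bl : List (SSF n)} {par : Bool}
      {t : GameTree Os C D} (O : SSF n) (hO : O ∈ Os)
      (hD : ∀ q ∈ B, ∃ w' ∈ O q.M q.w, (⟨q.M, w'⟩ : PointedModel n) ∈ D₁)
      {t' : GameTree Os (boxImage O A) D₁} :
      IsSubtree t t' bl par → IsSubtree t (.box O hO A B D₁ hD t') (O :: bl) par

/-! ### The canonical game tree `T^ψ` corresponding to a formula `ψ` -/

/-- Positions (nodes) in the syntax tree of a formula. -/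
inductive FPos {n : ℕ} {Os : Set (SSF n)} : MLFormula Os → Type 1 where
  | root (φ : MLFormula Os) : FPos φ
  | negChild {φ : MLFormula Os} : FPos φ → FPos (.neg φ)
  | orLeft {φ ψ : MLFormula Os} : FPos φ → FPos (.or φ ψ)
  | orRight {φ ψ : MLFormula Os} : FPos ψ → FPos (.or φ ψ)
  | boxChild {O : Os} {φ : MLFormula Os} : FPos φ → FPos (.box O φ)

/-- `nodeData φ v C D` computes, for the node `v` of the closed game tree `T^φ(⟨C∘D⟩)`
obtained by playing the Spoiler strategy corresponding to `φ` on the starting node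
`⟨C∘D⟩`, the tuple (left label class, right label class, boxlabels, parity of ¬'s). -/
def nodeData {n : ℕ} {Os : Set (SSF n)} :
    (φ : MLFormula Os) → FPos φ →
      Set (PointedModel n) → Set (PointedModel n) →
      Set (PointedModel n) × Set (PointedModel n) × List (SSF n) × Bool
  | _, .root _, C, D => (C, D, [], true)
  | .neg φ, .negChild q, C, D =>
      let r := nodeData φ q D C
      (r.1, r.2.1, r.2.2.1, !r.2.2.2)
  | .or φ₁ _, .orLeft q, C, D =>
      nodeData φ₁ q {m ∈ C | Satisfies m.M m.w φ₁} D
  | .or _ φ₂, .orRight q, C, D =>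
      nodeData φ₂ q {m ∈ C | Satisfies m.M m.w φ₂} D
  | .box O φ, .boxChild q, C, D =>
      let r := nodeData φ q (boxImage O.val C)
        {m ∈ boxImage O.val D | ¬ Satisfies m.M m.w φ}
      (r.1, r.2.1, O.val :: r.2.2.1, r.2.2.2)

/-- A position is a leaf of the game tree iff the corresponding subformula is a variable. -/
def isLeafPos {n : ℕ} {Os : Set (SSF n)} : (φ : MLFormula Os) → FPos φ → Prop
  | .var _, .root _ => True
  | .neg _, .root _ => False
  | .or _ _, .root _ => False
  | .box _ _, .root _ => False
  | .neg φ, .negChild q => isLeafPos φ q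
  | .or φ _, .orLeft q => isLeafPos φ q
  | .or _ ψ, .orRight q => isLeafPos ψ q
  | .box _ φ, .boxChild q => isLeafPos φ q

/-! ### The models `A*_{ℓ,i}` and `B*_{ℓ,s}` -/

/-- Extend a string `s ∈ {1,2}^i` to an infinite string (only the first `i` letters matter). -/
def extendStr {i : ℕ} (s : Fin i → Fin 2) : ℕ → Fin 2 :=
  fun d => if h : d < i then s ⟨d, h⟩ else 0

/-- The (0-based) `d`-th letter of the concatenation `a_ℓ^{s 0} a_ℓ^{s 1} …`. -/
def bLetter (ℓ : ℕ) (s : ℕ → Fin 2) (d : ℕ) : Fin 2 :=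
  altLetter (s (d / ℓ)) (d % ℓ)

/-- The extended model `B*_{ℓ,s}`: a path of length `i·ℓ` spelling `a^ℓ_s`, a trap world
(`none`) with a 1-loop and a 2-loop where `p` (variable 0) is true, and `j`-edges to the
trap from every base world lacking a `j`-successor. -/
def Bstar (ℓ i : ℕ) (s : ℕ → Fin 2) : KripkeModel 2 where
  W := Option (Fin (i * ℓ + 1))
  nonempty := ⟨none⟩
  R := fun j x y =>
    match x, y with
    | none, none => True
    | none, some _ => False
    | some d, some d' => (d' : ℕ) = (d : ℕ) + 1 ∧ bLetter ℓ s (d : ℕ) = j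
    | some d, none => ¬ (((d : ℕ) < i * ℓ) ∧ bLetter ℓ s (d : ℕ) = j)
  val := fun p => {x | p = 0 ∧ x = none}

/-- The root `w₀^B` of `B*_{ℓ,s}`. -/
def rootB (ℓ i : ℕ) (s : ℕ → Fin 2) : (Bstar ℓ i s).W :=
  some ⟨0, Nat.succ_pos _⟩

/-- Base worlds of `A*_{ℓ,i}`: a depth `d ≤ i·ℓ` together with the branch (which of the
two alternating words the current segment follows); the branch is normalized to `0` at
the main worlds (depths that are multiples of `ℓ`). -/
def AstarBase (ℓ i : ℕ) : Type :=
  {x : ℕ × Fin 2 // x.1 ≤ i * ℓ ∧ (x.1 % ℓ = 0 → x.2 = 0)}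

/-- Edges of the base model `A-base_{ℓ,i}` with label `j`. -/
def AbaseEdge (ℓ : ℕ) (j : Fin 2) (x y : ℕ × Fin 2) : Prop :=
  y.1 = x.1 + 1 ∧ ∃ c : Fin 2, j = altLetter c (x.1 % ℓ) ∧
    (x.1 % ℓ ≠ 0 → c = x.2) ∧ (y.1 % ℓ ≠ 0 → c = y.2)

/-- The extended model `A*_{ℓ,i}`: between consecutive main worlds there are two disjoint
paths spelling `a_ℓ^1` and `a_ℓ^2`; a trap world (`none`) with a 1-loop and a 2-loop where
`p` is false; `j`-edges to the trap from every base world lacking a `j`-successor.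
The variable `p` (variable 0) is true exactly at the final main world `w_i`. -/
def Astar (ℓ i : ℕ) : KripkeModel 2 where
  W := Option (AstarBase ℓ i)
  nonempty := ⟨none⟩
  R := fun j x y =>
    match x, y with
    | none, none => True
    | none, some _ => False
    | some a, some b => AbaseEdge ℓ j a.val b.val
    | some a, none => ¬ ∃ b : AstarBase ℓ i, AbaseEdge ℓ j a.val b.val
  val := fun p => {x | p = 0 ∧ x = some ⟨(i * ℓ, 0), le_refl _, fun _ => rfl⟩}

/-- The root `w₀^A` of `A*_{ℓ,i}`. -/
def rootA (ℓ i : ℕ) : (Astar ℓ i).W :=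
  some ⟨(0, 0), Nat.zero_le _, fun _ => rfl⟩

/-- The class `𝔸_{ℓ,i}`. -/
def classA (ℓ i : ℕ) : Set (PointedModel 2) :=
  {⟨Astar ℓ i, rootA ℓ i⟩}

/-- The class `𝔹_{ℓ,i}`. -/
def classB (ℓ i : ℕ) : Set (PointedModel 2) :=
  {q | ∃ s : Fin i → Fin 2, q = ⟨Bstar ℓ i (extendStr s), rootB ℓ i (extendStr s)⟩}

/-- A node with label classes `C`, `D` covers the string `s` if one of the classes
contains a pointed model `(B*_{ℓ,s}, w)`. -/
def Covers (ℓ i : ℕ) (C D : Set (PointedModel 2)) (s : Fin i → Fin 2) : Prop :=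
  ∃ w : (Bstar ℓ i (extendStr s)).W,
    (⟨Bstar ℓ i (extendStr s), w⟩ : PointedModel 2) ∈ C ∪ D

/-- The word `a^ℓ_s = a_ℓ^{s₁} a_ℓ^{s₂} … a_ℓ^{s_i}`. -/
def aWord (ℓ : ℕ) {i : ℕ} (s : Fin i → Fin 2) : List (Fin 2) :=
  (List.ofFn fun j => altWord (s j) ℓ).flatten

/-- A language is length-uniform if it is nonempty and all its words have the same length. -/
def LengthUniform (L : Set (List (Fin 2))) : Prop :=
  L.Nonempty ∧ ∃ d : ℕ, ∀ x ∈ L, x.length = d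

/-- `‖L‖`: the common word length of a length-uniform language. -/
noncomputable def luLen (L : Set (List (Fin 2))) : ℕ :=
  sInf {d : ℕ | ∃ x ∈ L, x.length = d}

/-- Concatenation of languages. -/
def langConcat (L₁ L₂ : Set (List (Fin 2))) : Set (List (Fin 2)) :=
  {x | ∃ a ∈ L₁, ∃ b ∈ L₂, x = a ++ b}

/-- `L₁ ∘ L₂ ∘ … ∘ L_m` for a list of languages. -/
def concatList (Ls : List (Set (List (Fin 2)))) : Set (List (Fin 2)) :=
  Ls.foldr langConcat {([] : List (Fin 2))}

/-- `𝒪`-bisimulations. -/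
def IsOBisim {n : ℕ} (Os : Set (SSF n)) (M₁ M₂ : KripkeModel n)
    (Z : M₁.W → M₂.W → Prop) : Prop :=
  ∀ w₁ w₂, Z w₁ w₂ →
    (∀ p : ℕ, w₁ ∈ M₁.val p ↔ w₂ ∈ M₂.val p) ∧
    (∀ O ∈ Os, ∀ w₁' ∈ O M₁ w₁, ∃ w₂' ∈ O M₂ w₂, Z w₁' w₂') ∧
    (∀ O ∈ Os, ∀ w₂' ∈ O M₂ w₂, ∃ w₁' ∈ O M₁ w₁, Z w₁' w₂')

theorem altWord_succ (c : Fin 2) (k : ℕ) : altWord c (k + 1) = c :: altWord (c + 1) k := by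
  have h : ∀ c : Fin 2, c = c + 1 + 1 := by decide
  simp only [altWord, List.range_succ_eq_map, List.map_cons, List.map_map]
  congr 1
  refine List.map_congr_left fun j _ => ?_
  simp only [altLetter, Function.comp, Nat.succ_eq_add_one]
  rcases Nat.mod_two_eq_zero_or_one j with hj | hj
  · have : (j + 1) % 2 = 1 := by omega
    simp [hj, this]
  · have : (j + 1) % 2 = 0 := by omega
    simp only [hj, this]
    simpa using h c

theorem length_altWord (c : Fin 2) (k : ℕ) : (altWord c k).length = k := by
  simp [altWord]

theorem fin_two_eq_add_one {a b : Fin 2} (h : a ≠ b) : a = b + 1 := by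
  revert a b; decide

theorem fin_two_add_one_ne_add_one {a b : Fin 2} (h : a ≠ b) : a + 1 ≠ b + 1 := by
  revert a b; decide

theorem bLetter_succ {ℓ : ℕ} (s : ℕ → Fin 2) {d : ℕ} (h : (d + 1) % ℓ ≠ 0) :
    bLetter ℓ s (d + 1) = bLetter ℓ s d + 1 := by
  have key : ∀ c : Fin 2, c = c + 1 + 1 := by decide
  have hdiv : (d + 1) / ℓ = d / ℓ :=
    Nat.succ_div_of_not_dvd fun hd => h (Nat.mod_eq_zero_of_dvd hd)
  have hmod : (d + 1) % ℓ = d % ℓ + 1 := by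
    have h₁ := Nat.div_add_mod (d + 1) ℓ
    have h₂ := Nat.div_add_mod d ℓ
    rw [hdiv] at h₁
    omega
  simp only [bLetter, altLetter, hdiv, hmod]
  rcases Nat.mod_two_eq_zero_or_one (d % ℓ) with hj | hj
  · have : (d % ℓ + 1) % 2 = 1 := by omega
    simp [hj, this]
  · have : (d % ℓ + 1) % 2 = 0 := by omega
    simp only [hj, this]
    simpa using key _

theorem bLetter_mul {ℓ : ℕ} (hℓ : 1 ≤ ℓ) (s : ℕ → Fin 2) (j : ℕ) :
    bLetter ℓ s (j * ℓ) = s j := by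
  simp [bLetter, altLetter, Nat.mul_div_cancel _ hℓ]

/-- The factor of length `k` starting at position `d` of the infinite word `b`. -/
def factor (b : ℕ → Fin 2) (d k : ℕ) : List (Fin 2) :=
  (List.range k).map fun e => b (d + e)

theorem factor_succ (b : ℕ → Fin 2) (d k : ℕ) :
    factor b d (k + 1) = b d :: factor b (d + 1) k := by
  simp only [factor, List.range_succ_eq_map, List.map_cons, List.map_map]
  congr 1
  refine List.map_congr_left fun e _ => ?_
  simp only [Function.comp, Nat.succ_eq_add_one]
  congr 1
  omega

theorem factor_congr {b b' : ℕ → Fin 2} {d k : ℕ} (h : factor b d k = factor b' d k) {e : ℕ}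
    (hde : d ≤ e) (hek : e < d + k) : b e = b' e := by
  have := List.map_inj_left.1 h (e - d) (List.mem_range.2 (by omega))
  simpa [Nat.add_sub_cancel' hde] using this

theorem altWord_eq_factor {ℓ : ℕ} (s : ℕ → Fin 2) (k : ℕ) (d : ℕ) (h : d % ℓ + k ≤ ℓ) :
    altWord (bLetter ℓ s d) k = factor (bLetter ℓ s) d k := by
  induction k generalizing d with
  | zero => rfl
  | succ k ih =>
    rw [altWord_succ, factor_succ]
    rcases k.eq_zero_or_pos with rfl | hk
    · rfl
    have hmod : (d + 1) % ℓ = d % ℓ + 1 := by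
      rw [Nat.add_mod, Nat.mod_eq_of_lt (show 1 < ℓ by omega), Nat.mod_eq_of_lt]
      omega
    rw [← bLetter_succ s (by omega), ih (d + 1) (by omega)]

/-- The three kinds of worlds of the separating models. -/
inductive WorldKind : Type where
  /-- worlds from which the critical world cannot be reached along the main word -/
  | safe
  /-- worlds from which the critical world is reached along the main word -/
  | risky
  /-- worlds inside a block all of whose letters read so far were flipped -/
  | flipped

/-- The separating model for the word `a_ℓ^{s 0} a_ℓ^{s 1} …`. Variable `0` fails exactly at
the risky world of depth `N`. Besides reading the main word, one may flip a proper nonempty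
initial part of a block, which always leads to risky worlds. -/
def sepModel (ℓ N : ℕ) (s : ℕ → Fin 2) : KripkeModel 2 where
  W := WorldKind × ℕ
  nonempty := ⟨(.safe, 0)⟩
  R := fun c u v => v.2 = u.2 + 1 ∧
    ((c = bLetter ℓ s u.2 ∧ ((u.1 = .safe ∧ v.1 = .safe) ∨
        (u.1 = .risky ∧ (v.1 = .safe ∨ (v.1 = .risky ∧ u.2 < N))))) ∨
      (c ≠ bLetter ℓ s u.2 ∧ v.2 % ℓ ≠ 0 ∧ (u.1 = .flipped ∨ u.2 % ℓ = 0) ∧ v.1 ≠ .safe))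
  val := fun q => {u | q = 0 ∧ u ≠ (.risky, N)}

section

variable {ℓ N : ℕ} {s : ℕ → Fin 2}

theorem sepModel_R_risky_of_safe {c : Fin 2} {d : ℕ} {v : WorldKind × ℕ}
    (h : (sepModel ℓ N s).R c (.safe, d) v) : (sepModel ℓ N s).R c (.risky, d) v := by
  refine ⟨h.1, h.2.imp (fun h => ?_) fun h => ?_⟩
  · simp_all
  · simp_all

theorem sSucc_risky_of_safe {w : List (Fin 2)} (hw : w ≠ []) {d : ℕ} {z : WorldKind × ℕ}
    (h : sSucc (sepModel ℓ N s) w (.safe, d) z) : sSucc (sepModel ℓ N s) w (.risky, d) z := by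
  cases w with
  | nil => exact absurd rfl hw
  | cons c w =>
    obtain ⟨u, hu, h⟩ := h
    exact ⟨u, sepModel_R_risky_of_safe hu, h⟩

theorem sSucc_factor_safe (d k : ℕ) :
    sSucc (sepModel ℓ N s) (factor (bLetter ℓ s) d k) (.safe, d) (.safe, d + k) := by
  induction k generalizing d with
  | zero => rfl
  | succ k ih =>
    rw [factor_succ]
    refine ⟨(.safe, d + 1), ?_, ?_⟩
    · simp [sepModel]
    · have := ih (d + 1)
      rwa [show d + 1 + k = d + (k + 1) by omega] at this

theorem sSucc_factor_risky (d k : ℕ) (h : d + k ≤ N) :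
    sSucc (sepModel ℓ N s) (factor (bLetter ℓ s) d k) (.risky, d) (.risky, d + k) := by
  induction k generalizing d with
  | zero => rfl
  | succ k ih =>
    rw [factor_succ]
    refine ⟨(.risky, d + 1), ?_, ?_⟩
    · have : d < N := by omega
      simp [sepModel, this]
    · have := ih (d + 1) (by omega)
      rwa [show d + 1 + k = d + (k + 1) by omega] at this

/-- A successor of a risky world is a successor of the safe world of the same depth, unless
it is the risky world reached by reading the main word. -/
theorem sSucc_risky {w : List (Fin 2)} {d : ℕ} (hd : d ≤ N) {z : WorldKind × ℕ}
    (h : sSucc (sepModel ℓ N s) w (.risky, d) z) :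
    sSucc (sepModel ℓ N s) w (.safe, d) z ∨
      (w = factor (bLetter ℓ s) d w.length ∧ z = (.risky, d + w.length) ∧ d + w.length ≤ N) := by
  induction w generalizing d with
  | nil => exact Or.inr ⟨rfl, h, hd⟩
  | cons c w ih =>
    obtain ⟨⟨k, e⟩, hu, h⟩ := h
    obtain ⟨rfl, hu⟩ : e = d + 1 ∧ _ := hu
    by_cases hc : c = bLetter ℓ s d
    · subst hc
      have hk : k = .safe ∨ (k = .risky ∧ d < N) := by simpa using hu
      have hs : (sepModel ℓ N s).R (bLetter ℓ s d) (.safe, d) (.safe, d + 1) := by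
        simp [sepModel]
      rcases hk with rfl | ⟨rfl, hdN⟩
      · exact Or.inl ⟨_, hs, h⟩
      · rcases ih hdN h with h | ⟨hw, hz, hN⟩
        · exact Or.inl ⟨_, hs, h⟩
        · refine Or.inr ⟨?_, ?_, ?_⟩
          · rw [List.length_cons, factor_succ, ← hw]
          · rw [hz, List.length_cons]
            congr 1
            omega
          · rw [List.length_cons]
            omega
    · refine Or.inl ⟨(k, d + 1), ?_, h⟩
      have hu' : (d + 1) % ℓ ≠ 0 ∧ d % ℓ = 0 ∧ k ≠ .safe := by simpa [hc] using hu
      simp [sepModel, hc, hu']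

theorem sSucc_altWord_flip {c : Fin 2} {k : ℕ} (hk : 1 ≤ k) {κ : WorldKind} {d : ℕ}
    (hκ : κ = .flipped ∨ d % ℓ = 0) (hc : c ≠ bLetter ℓ s d) (hdk : d % ℓ + k < ℓ) :
    sSucc (sepModel ℓ N s) (altWord c k) (κ, d) (.risky, d + k) := by
  induction k generalizing c κ d with
  | zero => omega
  | succ k ih =>
    have hmod : (d + 1) % ℓ = d % ℓ + 1 := by
      rw [Nat.add_mod, Nat.mod_eq_of_lt (show 1 < ℓ by omega), Nat.mod_eq_of_lt]
      omega
    have hne : (d + 1) % ℓ ≠ 0 := by omega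
    rw [altWord_succ]
    rcases k.eq_zero_or_pos with rfl | hk
    · exact ⟨_, ⟨rfl, Or.inr ⟨hc, hne, hκ, by simp⟩⟩, rfl⟩
    · refine ⟨(.flipped, d + 1), ⟨rfl, Or.inr ⟨hc, hne, hκ, by simp⟩⟩, ?_⟩
      have := ih (c := c + 1) (κ := .flipped) (d := d + 1) hk (Or.inl rfl)
        (by rw [bLetter_succ s hne]; exact fin_two_add_one_ne_add_one hc) (by omega)
      rwa [show d + 1 + k = d + (k + 1) by omega] at this

theorem eq_safe_of_sSucc_factor {d k : ℕ} {z : WorldKind × ℕ}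
    (h : sSucc (sepModel ℓ N s) (factor (bLetter ℓ s) d k) (.safe, d) z) :
    z = (.safe, d + k) := by
  induction k generalizing d with
  | zero => exact h
  | succ k ih =>
    rw [factor_succ] at h
    obtain ⟨⟨κ, e⟩, hu, h⟩ := h
    obtain ⟨rfl, hu⟩ : e = d + 1 ∧ _ := hu
    obtain rfl : κ = .safe := by simpa using hu
    rw [ih h]
    congr 1
    omega

/-- No world is reached by flipping all remaining letters of a block. -/
theorem not_sSucc_altWord_flip {c : Fin 2} {k : ℕ} (hk : 1 ≤ k) {κ : WorldKind} {d : ℕ}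
    (hc : c ≠ bLetter ℓ s d) (hdk : d % ℓ + k = ℓ) (z : WorldKind × ℕ) :
    ¬ sSucc (sepModel ℓ N s) (altWord c k) (κ, d) z := by
  induction k generalizing c κ d with
  | zero => omega
  | succ k ih =>
    rw [altWord_succ]
    rintro ⟨⟨κ', e⟩, hu, h⟩
    obtain ⟨rfl, hu⟩ : e = d + 1 ∧ _ := hu
    have hne : (d + 1) % ℓ ≠ 0 := (hu.resolve_left fun h => hc h.1).2.1
    rcases k.eq_zero_or_pos with rfl | hk
    · refine hne ?_
      rw [← Nat.mod_add_mod, hdk, Nat.mod_self]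
    · have hmod : (d + 1) % ℓ = d % ℓ + 1 := by
        rw [Nat.add_mod, Nat.mod_eq_of_lt (show 1 < ℓ by omega), Nat.mod_eq_of_lt]
        omega
      exact ih hk (by rw [bLetter_succ s hne]; exact fin_two_add_one_ne_add_one hc)
        (by omega) h

theorem mem_altLang_iff {k : ℕ} {w : List (Fin 2)} :
    w ∈ altLang k ↔ ∃ c, w = altWord c k := by
  simp [altLang, Fin.exists_fin_two]

theorem satisfies_boxAltIter_safe (hℓ : 1 ≤ ℓ) (r j : ℕ) :
    Satisfies (sepModel ℓ N s) (.safe, j * ℓ) (boxAltIter ℓ r) := by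
  induction r generalizing j with
  | zero => exact ⟨rfl, by simp⟩
  | succ r ih =>
    rintro z ⟨w, hw, hz⟩
    obtain ⟨c, rfl⟩ := mem_altLang_iff.1 hw
    by_cases hc : c = bLetter ℓ s (j * ℓ)
    · rw [hc, altWord_eq_factor s ℓ (j * ℓ) (by simp)] at hz
      rw [eq_safe_of_sSucc_factor hz, ← Nat.succ_mul]
      exact ih (j + 1)
    · exact absurd hz (not_sSucc_altWord_flip hℓ hc (by simp) z)

theorem not_satisfies_boxAltIter_risky (r j : ℕ) (hN : (j + r) * ℓ = N) :
    ¬ Satisfies (sepModel ℓ N s) (.risky, j * ℓ) (boxAltIter ℓ r) := by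
  induction r generalizing j with
  | zero =>
    rintro ⟨-, h⟩
    exact h (by rw [← hN, Nat.add_zero])
  | succ r ih =>
    intro h
    have hN' : (j + 1 + r) * ℓ = N := by rw [← hN]; ring
    refine ih (j + 1) hN' (h _ ⟨altWord (bLetter ℓ s (j * ℓ)) ℓ, mem_altLang_iff.2 ⟨_, rfl⟩, ?_⟩)
    rw [altWord_eq_factor s ℓ (j * ℓ) (by simp), Nat.succ_mul]
    refine sSucc_factor_risky _ _ ?_
    nlinarith

end

/-- Every operator of `ML_A⁺(I)` is given by a single letter or by an alternation language. -/
theorem MLAp_ops_cases {I : Set ℕ} {O : SSF 2} (hO : O ∈ MLAp_ops I) :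
    (∃ j : Fin 2, O = OfLang {[j]}) ∨ ∃ k ∈ I, O = OfLang (altLang k) := by
  rcases hO with ⟨k, hk, rfl⟩ | rfl | rfl
  · exact Or.inr ⟨k, hk, rfl⟩
  · exact Or.inl ⟨0, rfl⟩
  · exact Or.inl ⟨1, rfl⟩

section

variable {ℓ N : ℕ} {s : ℕ → Fin 2} {Os : Set (SSF 2)}

/-- The safe and the risky world of depth `d` cannot be told apart by a box that is false at
the former and true at the latter. -/
theorem satisfies_box_safe_of_risky {L : Set (List (Fin 2))} (hL : [] ∉ L)
    {hO : OfLang L ∈ Os} {χ : MLFormula Os} {d : ℕ}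
    (h : Satisfies (sepModel ℓ N s) (.risky, d) (.box ⟨_, hO⟩ χ)) :
    Satisfies (sepModel ℓ N s) (.safe, d) (.box ⟨_, hO⟩ χ) := by
  rintro z ⟨w, hw, hz⟩
  exact h z ⟨w, hw, sSucc_risky_of_safe (fun h => hL (h ▸ hw)) hz⟩

theorem exists_factor_of_separating_box {L : Set (List (Fin 2))}
    {hO : OfLang L ∈ Os} {χ : MLFormula Os} {d : ℕ} (hd : d ≤ N)
    (h₁ : Satisfies (sepModel ℓ N s) (.safe, d) (.box ⟨_, hO⟩ χ))
    (h₂ : ¬ Satisfies (sepModel ℓ N s) (.risky, d) (.box ⟨_, hO⟩ χ)) :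
    ∃ w ∈ L, w = factor (bLetter ℓ s) d w.length ∧ d + w.length ≤ N ∧
      Satisfies (sepModel ℓ N s) (.safe, d + w.length) χ ∧
      ¬ Satisfies (sepModel ℓ N s) (.risky, d + w.length) χ := by
  simp only [Satisfies, not_forall] at h₂
  obtain ⟨z, ⟨w, hw, hz⟩, hzχ⟩ := h₂
  rcases sSucc_risky hd hz with h | ⟨hwf, rfl, hN⟩
  · exact absurd (h₁ z ⟨w, hw, h⟩) hzχ
  · refine ⟨w, hw, hwf, hN, h₁ _ ⟨w, hw, ?_⟩, hzχ⟩
    nth_rewrite 1 [hwf]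
    exact sSucc_factor_safe _ _

/-- A separating alternation box at the beginning of a block has length at least `ℓ`. -/
theorem le_of_separating_altLang {k : ℕ} (hk : 1 ≤ k)
    {hO : OfLang (altLang k) ∈ Os} {χ : MLFormula Os} {d : ℕ} (hd : d ≤ N) (hdℓ : d % ℓ = 0)
    (h₁ : Satisfies (sepModel ℓ N s) (.safe, d) (.box ⟨_, hO⟩ χ))
    (h₂ : ¬ Satisfies (sepModel ℓ N s) (.risky, d) (.box ⟨_, hO⟩ χ)) : ℓ ≤ k := by
  by_contra! hkℓ
  obtain ⟨w, hw, -, -, -, hχ⟩ := exists_factor_of_separating_box hd h₁ h₂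
  obtain ⟨c, rfl⟩ := mem_altLang_iff.1 hw
  rw [length_altWord] at hχ
  obtain ⟨c', hc'⟩ : ∃ c', c' ≠ bLetter ℓ s d := exists_ne _
  exact hχ (h₁ _ ⟨altWord c' k, mem_altLang_iff.2 ⟨_, rfl⟩,
    sSucc_altWord_flip hk (Or.inr hdℓ) hc' (by omega)⟩)

end

theorem div_succ_le_div {ℓ i d k : ℕ} (hdℓ : d % ℓ = 0) (hk : ℓ < k) (h : d + k ≤ i * ℓ) :
    (i * ℓ - (d + k)) / (2 * ℓ) + 1 ≤ (i * ℓ - d) / (2 * ℓ) := by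
  rcases ℓ.eq_zero_or_pos with rfl | hℓ
  · omega
  obtain ⟨j, rfl⟩ := Nat.dvd_of_mod_eq_zero hdℓ
  obtain ⟨q, rfl⟩ : ∃ q, i = j + q :=
    Nat.exists_eq_add_of_le (Nat.le_of_mul_le_mul_left (by linarith [mul_comm i ℓ]) hℓ)
  have e₁ : (j + q) * ℓ - ℓ * j = q * ℓ := by
    rw [add_mul, mul_comm ℓ j, Nat.add_sub_cancel_left]
  rw [e₁, Nat.mul_div_mul_right _ _ hℓ, Nat.succ_le_iff, Nat.div_lt_iff_lt_mul (by omega)]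
  have h₁ : q ≤ 2 * (q / 2) + 1 := by omega
  have h₂ := Nat.mul_le_mul_right ℓ h₁
  have e₂ : q / 2 * (2 * ℓ) = 2 * (q / 2) * ℓ := by ring
  rw [e₂]
  rw [add_mul, one_mul] at h₂
  omega

/-- If `χ` separates the worlds of depth `d` in all models given by `S`, and the words of
these models agree up to depth `d`, then `S` has at most `|χ| 2^{(iℓ - d)/(2ℓ)}` elements. -/
theorem card_le_of_separates {I : Set ℕ} (hI : ∀ m ∈ I, 1 ≤ m) {ℓ : ℕ} (hℓ : 1 ≤ ℓ)
    (hnot : ℓ ∉ I) {i : ℕ} (χ : MLFormula (MLAp_ops I)) :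
    ∀ (d : ℕ) (S : Finset (Fin i → Fin 2)), d ≤ i * ℓ →
      (∀ s ∈ S, ∀ s' ∈ S, ∀ e < d,
        bLetter ℓ (extendStr s) e = bLetter ℓ (extendStr s') e) →
      ((∀ s ∈ S, Satisfies (sepModel ℓ (i * ℓ) (extendStr s)) (.safe, d) χ ∧
          ¬ Satisfies (sepModel ℓ (i * ℓ) (extendStr s)) (.risky, d) χ) ∨
        (∀ s ∈ S, Satisfies (sepModel ℓ (i * ℓ) (extendStr s)) (.risky, d) χ ∧
          ¬ Satisfies (sepModel ℓ (i * ℓ) (extendStr s)) (.safe, d) χ)) →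
      S.card ≤ χ.size * 2 ^ ((i * ℓ - d) / (2 * ℓ)) := by
  induction χ with
  | var q =>
    intro d S hd hagree hsep
    refine le_trans (Finset.card_le_one.2 fun s hs s' hs' => ?_)
      (Nat.mul_pos Nat.one_pos (by positivity))
    rcases hsep with hsep | hsep
    · obtain ⟨⟨hq, -⟩, h₂⟩ := hsep s hs
      obtain rfl : d = i * ℓ := by
        by_contra hne
        refine h₂ ⟨hq, ?_⟩
        simpa using hne
      funext j
      have := hagree s hs s' hs' (j * ℓ) (Nat.mul_lt_mul_of_pos_right j.2 hℓ)
      simpa [bLetter_mul hℓ, extendStr] using this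
    · obtain ⟨⟨hq, -⟩, h₂⟩ := hsep s hs
      exact absurd ⟨hq, by simp⟩ h₂
  | neg χ ih =>
    intro d S hd hagree hsep
    refine (ih d S hd hagree ?_).trans (Nat.mul_le_mul_right _ (Nat.le_succ _))
    simp only [Satisfies, not_not] at hsep
    exact hsep.symm.imp (fun h s hs => (h s hs).symm) (fun h s hs => (h s hs).symm)
  | or χ₁ χ₂ ih₁ ih₂ =>
    intro d S hd hagree hsep
    have split : ∀ κ κ' : WorldKind,
        (∀ s ∈ S, Satisfies (sepModel ℓ (i * ℓ) (extendStr s)) (κ, d) (χ₁.or χ₂) ∧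
          ¬ Satisfies (sepModel ℓ (i * ℓ) (extendStr s)) (κ', d) (χ₁.or χ₂)) →
        ∃ S₁ ⊆ S, ∃ S₂ ⊆ S, S ⊆ S₁ ∪ S₂ ∧
          (∀ s ∈ S₁, Satisfies (sepModel ℓ (i * ℓ) (extendStr s)) (κ, d) χ₁ ∧
            ¬ Satisfies (sepModel ℓ (i * ℓ) (extendStr s)) (κ', d) χ₁) ∧
          (∀ s ∈ S₂, Satisfies (sepModel ℓ (i * ℓ) (extendStr s)) (κ, d) χ₂ ∧
            ¬ Satisfies (sepModel ℓ (i * ℓ) (extendStr s)) (κ', d) χ₂) := by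
      intro κ κ' h
      simp only [Satisfies, not_or] at h
      refine ⟨S.filter fun s => Satisfies (sepModel ℓ (i * ℓ) (extendStr s)) (κ, d) χ₁,
        Finset.filter_subset _ _,
        S.filter fun s => Satisfies (sepModel ℓ (i * ℓ) (extendStr s)) (κ, d) χ₂,
        Finset.filter_subset _ _, fun s hs => ?_, fun s hs => ?_, fun s hs => ?_⟩
      · rw [Finset.mem_union, Finset.mem_filter, Finset.mem_filter]
        exact (h s hs).1.imp (⟨hs, ·⟩) (⟨hs, ·⟩)
      · rw [Finset.mem_filter] at hs
        exact ⟨hs.2, (h s hs.1).2.1⟩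
      · rw [Finset.mem_filter] at hs
        exact ⟨hs.2, (h s hs.1).2.2⟩
    obtain ⟨S₁, hS₁, S₂, hS₂, hS, h⟩ : ∃ S₁ ⊆ S, ∃ S₂ ⊆ S, S ⊆ S₁ ∪ S₂ ∧
        S₁.card ≤ χ₁.size * 2 ^ ((i * ℓ - d) / (2 * ℓ)) ∧
        S₂.card ≤ χ₂.size * 2 ^ ((i * ℓ - d) / (2 * ℓ)) := by
      rcases hsep with hsep | hsep
      · obtain ⟨S₁, hS₁, S₂, hS₂, hS, h₁, h₂⟩ := split _ _ hsep
        exact ⟨S₁, hS₁, S₂, hS₂, hS,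
          ih₁ d S₁ hd (fun s hs s' hs' => hagree s (hS₁ hs) s' (hS₁ hs')) (Or.inl h₁),
          ih₂ d S₂ hd (fun s hs s' hs' => hagree s (hS₂ hs) s' (hS₂ hs')) (Or.inl h₂)⟩
      · obtain ⟨S₁, hS₁, S₂, hS₂, hS, h₁, h₂⟩ := split _ _ hsep
        exact ⟨S₁, hS₁, S₂, hS₂, hS,
          ih₁ d S₁ hd (fun s hs s' hs' => hagree s (hS₁ hs) s' (hS₁ hs')) (Or.inr h₁),
          ih₂ d S₂ hd (fun s hs s' hs' => hagree s (hS₂ hs) s' (hS₂ hs')) (Or.inr h₂)⟩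
    calc S.card ≤ (S₁ ∪ S₂).card := Finset.card_le_card hS
      _ ≤ S₁.card + S₂.card := Finset.card_union_le _ _
      _ ≤ χ₁.size * 2 ^ ((i * ℓ - d) / (2 * ℓ)) + χ₂.size * 2 ^ ((i * ℓ - d) / (2 * ℓ)) :=
        Nat.add_le_add h.1 h.2
      _ = (χ₁.size + χ₂.size) * 2 ^ ((i * ℓ - d) / (2 * ℓ)) := (add_mul _ _ _).symm
      _ ≤ _ := Nat.mul_le_mul_right _ (Nat.le_succ _)
  | box O χ ih =>
    obtain ⟨O, hO⟩ := O
    intro d S hd hagree hsep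
    rcases S.eq_empty_or_nonempty with rfl | hne
    · simp
    -- If all strings of `T` follow the same word `w`, the induction hypothesis applies to `T`.
    have follow : ∀ T ⊆ S, ∀ w : List (Fin 2), T.Nonempty →
        (∀ s ∈ T, w = factor (bLetter ℓ (extendStr s)) d w.length ∧ d + w.length ≤ i * ℓ ∧
          Satisfies (sepModel ℓ (i * ℓ) (extendStr s)) (.safe, d + w.length) χ ∧
          ¬ Satisfies (sepModel ℓ (i * ℓ) (extendStr s)) (.risky, d + w.length) χ) →
        T.card ≤ χ.size * 2 ^ ((i * ℓ - (d + w.length)) / (2 * ℓ)) := by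
      intro T hT w ⟨t, ht⟩ h
      refine ih _ T (h t ht).2.1 (fun s hs s' hs' e he => ?_) (Or.inl fun s hs => (h s hs).2.2)
      rcases lt_or_ge e d with hed | hed
      · exact hagree s (hT hs) s' (hT hs') e hed
      · exact factor_congr ((h s hs).1.symm.trans (h s' hs').1) hed he
    have weaken : ∀ k, χ.size * 2 ^ ((i * ℓ - (d + k)) / (2 * ℓ)) ≤
        (MLFormula.box ⟨O, hO⟩ χ).size * 2 ^ ((i * ℓ - d) / (2 * ℓ)) := fun k =>
      Nat.mul_le_mul (Nat.le_succ _)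
        (Nat.pow_le_pow_right two_pos (Nat.div_le_div_right (by omega)))
    obtain ⟨s₀, hs₀⟩ := hne
    rcases MLAp_ops_cases hO with ⟨j, rfl⟩ | ⟨k, hkI, rfl⟩
    · rcases hsep with hsep | hsep
      · refine (follow S subset_rfl [j] ⟨s₀, hs₀⟩ fun s hs => ?_).trans (weaken _)
        obtain ⟨w, rfl, hw⟩ := exists_factor_of_separating_box hd (hsep s hs).1 (hsep s hs).2
        exact hw
      · exact absurd (satisfies_box_safe_of_risky (by simp) (hsep s₀ hs₀).1) (hsep s₀ hs₀).2
    have hk := hI k hkI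
    rcases hsep with hsep | hsep
    swap
    · refine absurd (satisfies_box_safe_of_risky (fun h => ?_) (hsep s₀ hs₀).1) (hsep s₀ hs₀).2
      obtain ⟨c, hc⟩ := mem_altLang_iff.1 h
      have := length_altWord c k
      rw [← hc, List.length_nil] at this
      omega
    have step : ∀ s ∈ S,
        altWord (bLetter ℓ (extendStr s) d) k = factor (bLetter ℓ (extendStr s)) d k ∧
        d + k ≤ i * ℓ ∧
        Satisfies (sepModel ℓ (i * ℓ) (extendStr s)) (.safe, d + k) χ ∧
        ¬ Satisfies (sepModel ℓ (i * ℓ) (extendStr s)) (.risky, d + k) χ := by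
      intro s hs
      obtain ⟨w, hw, hw'⟩ := exists_factor_of_separating_box hd (hsep s hs).1 (hsep s hs).2
      obtain ⟨c, rfl⟩ := mem_altLang_iff.1 hw
      rw [length_altWord] at hw'
      obtain ⟨k, rfl⟩ := Nat.exists_eq_add_of_le' hk
      have hc := hw'.1
      rw [altWord_succ, factor_succ, List.cons.injEq] at hc
      rwa [← hc.1]
    have followAlt : ∀ T ⊆ S, ∀ c : Fin 2, (∀ s ∈ T, bLetter ℓ (extendStr s) d = c) →
        T.card ≤ χ.size * 2 ^ ((i * ℓ - (d + k)) / (2 * ℓ)) := by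
      intro T hT c h
      rcases T.eq_empty_or_nonempty with rfl | hne
      · simp
      have := follow T hT (altWord c k) hne fun s hs => by
        rw [length_altWord, ← h s hs]
        exact step s (hT hs)
      rwa [length_altWord] at this
    by_cases hdℓ : d % ℓ = 0
    · have hℓk : ℓ < k :=
        lt_of_le_of_ne (le_of_separating_altLang hk hd hdℓ (hsep s₀ hs₀).1 (hsep s₀ hs₀).2)
          fun h => hnot (h ▸ hkI)
      have hdiv := div_succ_le_div hdℓ hℓk (step s₀ hs₀).2.1
      have h₀ := followAlt (S.filter fun s => bLetter ℓ (extendStr s) d = 0)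
        (Finset.filter_subset _ _) 0 fun s hs => (Finset.mem_filter.1 hs).2
      have h₁ := followAlt (S.filter fun s => ¬ bLetter ℓ (extendStr s) d = 0)
        (Finset.filter_subset _ _) 1 fun s hs => fin_two_eq_add_one (Finset.mem_filter.1 hs).2
      calc S.card = _ := (Finset.card_filter_add_card_filter_not
              (fun s => bLetter ℓ (extendStr s) d = 0)).symm
        _ ≤ _ := Nat.add_le_add h₀ h₁
        _ = χ.size * 2 ^ ((i * ℓ - (d + k)) / (2 * ℓ) + 1) := by ring
        _ ≤ _ := Nat.mul_le_mul (Nat.le_succ _) (Nat.pow_le_pow_right two_pos hdiv)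
    · refine (followAlt S subset_rfl (bLetter ℓ (extendStr s₀) d) fun s hs => ?_).trans (weaken k)
      obtain ⟨e, rfl⟩ := Nat.exists_eq_succ_of_ne_zero (show d ≠ 0 by rintro rfl; simp at hdℓ)
      rw [Nat.succ_eq_add_one, bLetter_succ _ hdℓ, bLetter_succ _ hdℓ,
        hagree s hs s₀ hs₀ e (Nat.lt_succ_self e)]

/-- if `ℓ ∉ I`, `i` even and `ψ` is an `ML_A⁺(I)`-formula equivalent to
`[A_ℓ]^i p`, then `|ψ| ≥ 2^{i/2}`. -/
theorem statement8 (I : Set ℕ) (hI : ∀ m ∈ I, 1 ≤ m) (ℓ : ℕ) (hℓ : 1 ≤ ℓ) (hnot : ℓ ∉ I)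
    (i : ℕ) (hi : Even i) (ψ : MLFormula (MLAp_ops I))
    (hequiv : FEquiv (boxAltIter ℓ i) ψ) :
    2 ^ (i / 2) ≤ ψ.size := by
  have hcard := card_le_of_separates hI hℓ hnot ψ 0 (Finset.univ : Finset (Fin i → Fin 2))
    (Nat.zero_le _) (by simp) <| Or.inl fun s _ => by
      have h₁ := satisfies_boxAltIter_safe (N := i * ℓ) (s := extendStr s) hℓ i 0
      have h₂ := not_satisfies_boxAltIter_risky (ℓ := ℓ) (N := i * ℓ) (s := extendStr s) i 0
        (by rw [Nat.zero_add])
      rw [Nat.zero_mul] at h₁ h₂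
      exact ⟨(hequiv _ _).1 h₁, fun h => h₂ ((hequiv _ _).2 h)⟩
  obtain ⟨m, rfl⟩ := hi
  rw [Finset.card_univ, Fintype.card_fun, Fintype.card_fin, Fintype.card_fin, Nat.sub_zero,
    Nat.mul_div_mul_right _ _ hℓ, show (m + m) / 2 = m by omega, pow_add] at hcard
  rw [show (m + m) / 2 = m by omega]
  exact Nat.le_of_mul_le_mul_right hcard (by positivity)
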